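/- Let m be a universal semimeasure with an approximation (m_s) from below satisfying m_1(x) ≥ c₀·2^{−2|x|} for some fixed c₀ > 0 and all x, let m(·|·) be a universal conditional semimeasure with a fixed approximation (m_t(·|·)) from below, and define u_h(x) = ⨅ s, m_{h(x,s)}(x|s) / m_s(x) for computable h. Then for every computable h there exist a sequence of natural numbers t_1, t_2, t_3, … and a constant c > 0 such that for every bitstring x and every i with i ≥ |x| and i ≥ 2, either m_{t_{i+1}}(x) ≥ 2 · m_{t_i}(x) or u_h(x) < 2c · i · (log i)². -/

import Mathlib

open scoped ENNReal NNReal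

/-- Interpret a rational approximation value as an extended nonnegative real. -/
noncomputable def qval (q : ℚ) : ℝ≥0∞ := ENNReal.ofReal q

/-- Interpret a value in `ℚ≥0 ∪ {∞}` (with nonnegativity required separately)
as an extended nonnegative real; `none` stands for `∞`. -/
noncomputable def qtval (q : Option ℚ) : ℝ≥0∞ := q.elim ⊤ (fun a => ENNReal.ofReal a)

/-- A (discrete) semimeasure on bitstrings. -/
def IsSemimeasure (P : List Bool → ℝ≥0∞) : Prop := ∑' x, P x ≤ 1

/-- `Ps` is a computable approximation of `P` from below (by nonnegative rationals,
nondecreasing in the stage). -/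
def IsApproxFromBelow (P : List Bool → ℝ≥0∞) (Ps : List Bool → ℕ → ℚ) : Prop :=
  Computable (fun p : List Bool × ℕ => Ps p.1 p.2) ∧
  (∀ x s, 0 ≤ Ps x s) ∧
  (∀ x, Monotone fun s => Ps x s) ∧
  (∀ x, P x = ⨆ s, qval (Ps x s))

/-- `P` is lower semicomputable. -/
def LowerSemicomputable (P : List Bool → ℝ≥0∞) : Prop := ∃ Ps, IsApproxFromBelow P Ps

/-- `es` is a computable approximation of `e` from above (by values in `ℚ≥0 ∪ {∞}`,
nonincreasing in the stage). -/
def IsApproxFromAbove (e : List Bool → ℝ≥0∞) (es : List Bool → ℕ → Option ℚ) : Prop :=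
  Computable (fun p : List Bool × ℕ => es p.1 p.2) ∧
  (∀ x s, ∀ a ∈ es x s, (0:ℚ) ≤ a) ∧
  (∀ x, Antitone fun s => qtval (es x s)) ∧
  (∀ x, e x = ⨅ s, qtval (es x s))

/-- `e` is upper semicomputable. -/
def UpperSemicomputable (e : List Bool → ℝ≥0∞) : Prop := ∃ es, IsApproxFromAbove e es

/-- `e` is a sumtest for the semimeasure `P`. -/
def IsSumtest (P e : List Bool → ℝ≥0∞) : Prop := ∑' x, P x * e x ≤ 1

/-- `m` is a universal (lower semicomputable) semimeasure. -/
def IsUniversalSemimeasure (m : List Bool → ℝ≥0∞) : Prop :=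
  IsSemimeasure m ∧ LowerSemicomputable m ∧
  ∀ P, IsSemimeasure P → LowerSemicomputable P → ∃ c : ℝ≥0, 0 < c ∧ ∀ x, P x ≤ c * m x

/-- A conditional semimeasure `m(·|·)`. -/
def IsCondSemimeasure (m : List Bool → ℕ → ℝ≥0∞) : Prop := ∀ s, ∑' x, m x s ≤ 1

/-- `ms` is a computable approximation from below of the conditional semimeasure `m`:
`ms t x s` approximates `m(x|s)`, nondecreasing in the stage `t`. -/
def IsCondApproxFromBelow (m : List Bool → ℕ → ℝ≥0∞) (ms : ℕ → List Bool → ℕ → ℚ) : Prop :=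
  Computable (fun p : ℕ × List Bool × ℕ => ms p.1 p.2.1 p.2.2) ∧
  (∀ t x s, 0 ≤ ms t x s) ∧
  (∀ x s, Monotone fun t => ms t x s) ∧
  (∀ x s, m x s = ⨆ t, qval (ms t x s))

/-- The conditional semimeasure `m` is lower semicomputable (jointly). -/
def CondLowerSemicomputable (m : List Bool → ℕ → ℝ≥0∞) : Prop :=
  ∃ ms, IsCondApproxFromBelow m ms

/-- `m(·|·)` is a universal lower semicomputable conditional semimeasure. -/
def IsUniversalCondSemimeasure (m : List Bool → ℕ → ℝ≥0∞) : Prop :=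
  IsCondSemimeasure m ∧ CondLowerSemicomputable m ∧
  ∀ m', IsCondSemimeasure m' → CondLowerSemicomputable m' →
    ∃ c : ℝ≥0, 0 < c ∧ ∀ x s, m' x s ≤ c * m x s

/-- The code of a rational in its (non-surjective) encoding by numerator and denominator. -/
def ratCode (q : ℚ) : ℕ := @Encodable.encode ℚ Rat.instEncodable q

theorem ratCode_eq_pair (q : ℚ) : ratCode q = Nat.pair (Encodable.encode q.num) q.den := rfl

theorem Int.natAbs_eq_encode_succ_div_two (z : ℤ) : z.natAbs = (Encodable.encode z + 1) / 2 := by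
  cases z with
  | ofNat n =>
    have h : Encodable.encode (Int.ofNat n) = 2 * n := rfl
    rw [h, show (Int.ofNat n).natAbs = n from rfl]; omega
  | negSucc n =>
    have h : Encodable.encode (Int.negSucc n) = 2 * n + 1 := rfl
    rw [h, show (Int.negSucc n).natAbs = n + 1 from rfl]; omega

theorem Int.encode_of_nonneg {z : ℤ} (hz : 0 ≤ z) : Encodable.encode z = 2 * z.natAbs := by
  cases z with
  | ofNat n => rfl
  | negSucc n => simp at hz

theorem Int.nonneg_of_even_encode {z : ℤ} (hz : Encodable.encode z % 2 = 0) : 0 ≤ z := by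
  cases z with
  | ofNat n => simp
  | negSucc n =>
    have h : Encodable.encode (Int.negSucc n) = 2 * n + 1 := rfl
    omega

theorem Int.exists_encode_eq (n : ℕ) : ∃ z : ℤ, Encodable.encode z = n := by
  obtain ⟨k, hk | hk⟩ := Nat.even_or_odd' n
  · exact ⟨Int.ofNat k, hk.symm⟩
  · exact ⟨Int.negSucc k, hk.symm⟩

theorem mem_range_ratCode_iff (y : ℕ) :
    y ∈ Set.range ratCode ↔
      y.unpair.2 ≠ 0 ∧ ((y.unpair.1 + 1) / 2).Coprime y.unpair.2 := by
  constructor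
  · rintro ⟨q, rfl⟩
    rw [ratCode_eq_pair, Nat.unpair_pair, ← Int.natAbs_eq_encode_succ_div_two]
    exact ⟨q.den_nz, q.reduced⟩
  · rintro ⟨h0, hc⟩
    obtain ⟨z, hz⟩ := Int.exists_encode_eq y.unpair.1
    rw [← hz, ← Int.natAbs_eq_encode_succ_div_two] at hc
    refine ⟨⟨z, y.unpair.2, h0, hc⟩, ?_⟩
    rw [ratCode_eq_pair, hz, Nat.pair_unpair]

theorem coprime_iff_forall_lt {a b : ℕ} (hb : b ≠ 0) :
    a.Coprime b ↔ ∀ e < b + 1, ¬(2 ≤ e ∧ a % e = 0 ∧ b % e = 0) := by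
  constructor
  · rintro h e - ⟨h2, ha, hb⟩
    have := Nat.eq_one_of_dvd_coprimes h (Nat.dvd_of_mod_eq_zero ha) (Nat.dvd_of_mod_eq_zero hb)
    omega
  · intro h
    by_contra hc
    have hpos : 0 < a.gcd b := Nat.gcd_pos_of_pos_right _ (Nat.pos_of_ne_zero hb)
    have hle := Nat.le_of_dvd (Nat.pos_of_ne_zero hb) (Nat.gcd_dvd_right a b)
    have hne : a.gcd b ≠ 1 := hc
    exact h (a.gcd b) (by omega) ⟨by omega, Nat.mod_eq_zero_of_dvd (Nat.gcd_dvd_left a b),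
      Nat.mod_eq_zero_of_dvd (Nat.gcd_dvd_right a b)⟩

theorem primrecPred_mem_range_ratCode : PrimrecPred (· ∈ Set.range ratCode) := by
  have hb : Primrec fun y : ℕ => y.unpair.2 := Primrec.snd.comp Primrec.unpair
  have ha : Primrec fun y : ℕ => (y.unpair.1 + 1) / 2 :=
    Primrec.nat_div.comp (Primrec.succ.comp (Primrec.fst.comp Primrec.unpair)) (Primrec.const 2)
  have hrel : PrimrecRel fun e y : ℕ =>
      ¬(2 ≤ e ∧ ((y.unpair.1 + 1) / 2) % e = 0 ∧ y.unpair.2 % e = 0) := by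
    refine PrimrecPred.not (PrimrecPred.and ?_ (PrimrecPred.and ?_ ?_))
    · exact Primrec.nat_le.comp (Primrec.const 2) Primrec.fst
    · exact Primrec.eq.comp (Primrec.nat_mod.comp (ha.comp Primrec.snd) Primrec.fst)
        (Primrec.const 0)
    · exact Primrec.eq.comp (Primrec.nat_mod.comp (hb.comp Primrec.snd) Primrec.fst)
        (Primrec.const 0)
  have hall := (PrimrecRel.forall_lt hrel).comp (Primrec.succ.comp hb) Primrec.id
  refine ((Primrec.eq.comp hb (Primrec.const 0)).not.and hall).of_eq fun y => ?_
  rw [mem_range_ratCode_iff]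
  exact and_congr_right fun h => (coprime_iff_forall_lt h).symm

/-- The code of a rational in its bijective encoding, the one `Computable` refers to. -/
def ratRank (q : ℚ) : ℕ := @Encodable.encode ℚ Primcodable.toEncodable q

/-- The rational with a given code in the bijective encoding. -/
def ratUnrank (n : ℕ) : ℚ := Denumerable.ofNat ℚ n

theorem ratUnrank_ratRank (q : ℚ) : ratUnrank (ratRank q) = q := Denumerable.ofNat_encode q

theorem ratRank_ratUnrank (n : ℕ) : ratRank (ratUnrank n) = n :=
  Denumerable.encode_ofNat (α := ℚ) n

theorem ratRank_injective : Function.Injective ratRank :=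
  Function.LeftInverse.injective ratUnrank_ratRank

theorem primrec_ratRank : Primrec ratRank := Primrec.encode

theorem computable_ratUnrank : Computable ratUnrank := Computable.ofNat ℚ

theorem ratRank_eq_countP (q : ℚ) [DecidablePred (· ∈ Set.range ratCode)] :
    ratRank q = (List.range (ratCode q)).countP (· ∈ Set.range ratCode) := by
  have h : ratRank q = @List.countP ℕ (fun y => @decide (y ∈ Set.range
    (@Encodable.encode ℚ Rat.instEncodable)) (Encodable.decidableRangeEncode ℚ y))
    (List.range (ratCode q)) := rfl
  rw [h]
  congr!

theorem computable_ratCode : Computable ratCode := by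
  classical
  have hmem := primrecPred_mem_range_ratCode.decide
  have hcount : Primrec fun y : ℕ => (List.range y).countP (· ∈ Set.range ratCode) := by
    refine (Primrec.list_length.comp ((Primrec.listFilter primrecPred_mem_range_ratCode).comp
      Primrec.list_range)).of_eq fun y => ?_
    rw [List.countP_eq_length_filter]
  have htest : Computable₂ fun (q : ℚ) (y : ℕ) => decide (y ∈ Set.range ratCode) &&
      decide ((List.range y).countP (· ∈ Set.range ratCode) = ratRank q) := by
    refine Primrec₂.to_comp ?_
    exact Primrec.and.comp (hmem.comp Primrec.snd)
      (Primrec.eq.decide.comp (hcount.comp Primrec.snd) (primrec_ratRank.comp Primrec.fst))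
  refine (Partrec.rfind htest.partrec₂).of_eq_tot fun q => ?_
  rw [Nat.mem_rfind]
  constructor
  · simp [ratRank_eq_countP]
  · intro y hy
    simp only [PFun.coe_val, Part.mem_some_iff]
    symm
    rw [Bool.and_eq_false_iff, decide_eq_false_iff_not, decide_eq_false_iff_not]
    by_contra! hcon
    obtain ⟨⟨r, rfl⟩, hr⟩ := hcon
    rw [← ratRank_eq_countP] at hr
    exact absurd (ratRank_injective hr) fun h => by simp [h] at hy

theorem Rat.computable_encode_num : Computable fun q : ℚ => Encodable.encode q.num :=
  (Computable.fst.comp (Computable.unpair.comp computable_ratCode)).of_eq fun q => by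
    simp [ratCode_eq_pair]

theorem Rat.computable_den : Computable fun q : ℚ => q.den :=
  (Computable.snd.comp (Computable.unpair.comp computable_ratCode)).of_eq fun q => by
    simp [ratCode_eq_pair]

theorem Rat.computable_natAbs_num : Computable fun q : ℚ => q.num.natAbs :=
  (Primrec.nat_div.to_comp.comp (Computable.succ.comp Rat.computable_encode_num)
    (Computable.const 2)).of_eq fun _ => (Int.natAbs_eq_encode_succ_div_two _).symm

section RationalFunctions

variable {α : Type*} [Primcodable α]

theorem Rat.natAbs_num_div_den {q : ℚ} (hq : 0 ≤ q) : (q.num.natAbs : ℚ) / q.den = q := by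
  have h : ((q.num.natAbs : ℤ) : ℚ) = q.num := by
    rw [Int.natAbs_of_nonneg (Rat.num_nonneg.2 hq)]
  rw [← Int.cast_natCast, h, Rat.num_div_den]

theorem Computable.rat_natCast_div {n d : α → ℕ} (hn : Computable n) (hd : Computable d)
    (hd0 : ∀ a, d a ≠ 0) : Computable fun a => (n a / d a : ℚ) := by
  have hq : Computable fun p : α × ℕ => ratUnrank p.2 :=
    computable_ratUnrank.comp Computable.snd
  have htest : Computable₂ fun (a : α) (y : ℕ) =>
      decide (Encodable.encode (ratUnrank y).num % 2 = 0) &&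
        decide ((ratUnrank y).num.natAbs * d a = n a * (ratUnrank y).den) := by
    refine Primrec.and.to_comp.comp ?_ ?_
    · exact Primrec.eq.decide.to_comp.comp (Primrec.nat_mod.to_comp.comp
        (Rat.computable_encode_num.comp hq) (Computable.const 2)) (Computable.const 0)
    · exact Primrec.eq.decide.to_comp.comp
        (Primrec.nat_mul.to_comp.comp (Rat.computable_natAbs_num.comp hq) (hd.comp Computable.fst))
        (Primrec.nat_mul.to_comp.comp (hn.comp Computable.fst) (Rat.computable_den.comp hq))
  have htest_iff : ∀ a (q : ℚ), (Encodable.encode q.num % 2 = 0 ∧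
      q.num.natAbs * d a = n a * q.den) ↔ q = n a / d a := by
    intro a q
    have hda : (d a : ℚ) ≠ 0 := Nat.cast_ne_zero.2 (hd0 a)
    have hqd : (q.den : ℚ) ≠ 0 := Nat.cast_ne_zero.2 q.den_nz
    have key : 0 ≤ q → (q.num.natAbs * d a = n a * q.den ↔ q = n a / d a) := by
      intro h0
      conv_rhs => rw [← Rat.natAbs_num_div_den h0]
      rw [div_eq_div_iff hqd hda]
      norm_cast
    constructor
    · rintro ⟨h1, h2⟩
      exact (key (Rat.num_nonneg.1 (Int.nonneg_of_even_encode h1))).1 h2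
    · intro h
      have h0 : 0 ≤ q := by rw [h]; positivity
      refine ⟨?_, (key h0).2 h⟩
      rw [Int.encode_of_nonneg (Rat.num_nonneg.2 h0)]
      simp
  refine ((Partrec.rfind htest.partrec₂).map
    (computable_ratUnrank.comp Computable.snd).to₂).of_eq_tot fun a => ?_
  refine (Part.mem_map_iff _).2 ⟨ratRank (n a / d a), Nat.mem_rfind.2 ⟨?_, ?_⟩, ?_⟩
  · have := (htest_iff a (n a / d a)).2 rfl
    simp only [PFun.coe_val, Part.mem_some_iff, ratUnrank_ratRank]
    simp [this]
  · intro y hy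
    simp only [PFun.coe_val, Part.mem_some_iff]
    symm
    rw [Bool.and_eq_false_iff, decide_eq_false_iff_not, decide_eq_false_iff_not, ← not_and_or,
      htest_iff]
    intro h
    rw [← h, ratRank_ratUnrank] at hy
    exact lt_irrefl y hy
  · exact ratUnrank_ratRank _

theorem Computable.rat_add {f g : α → ℚ} (hf : Computable f) (hg : Computable g)
    (hf0 : ∀ a, 0 ≤ f a) (hg0 : ∀ a, 0 ≤ g a) : Computable fun a => f a + g a := by
  refine (Computable.rat_natCast_div
    (Primrec.nat_add.to_comp.comp
      (Primrec.nat_mul.to_comp.comp (Rat.computable_natAbs_num.comp hf)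
        (Rat.computable_den.comp hg))
      (Primrec.nat_mul.to_comp.comp (Rat.computable_den.comp hf)
        (Rat.computable_natAbs_num.comp hg)))
    (Primrec.nat_mul.to_comp.comp (Rat.computable_den.comp hf) (Rat.computable_den.comp hg))
    fun a => Nat.mul_ne_zero (f a).den_nz (g a).den_nz).of_eq fun a => ?_
  push_cast
  rw [← div_add_div _ _ (Nat.cast_ne_zero.2 (f a).den_nz) (Nat.cast_ne_zero.2 (g a).den_nz),
    Rat.natAbs_num_div_den (hf0 a), Rat.natAbs_num_div_den (hg0 a)]

theorem Computable.rat_mul {f g : α → ℚ} (hf : Computable f) (hg : Computable g)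
    (hf0 : ∀ a, 0 ≤ f a) (hg0 : ∀ a, 0 ≤ g a) : Computable fun a => f a * g a := by
  refine (Computable.rat_natCast_div
    (Primrec.nat_mul.to_comp.comp
      (Rat.computable_natAbs_num.comp hf) (Rat.computable_natAbs_num.comp hg))
    (Primrec.nat_mul.to_comp.comp (Rat.computable_den.comp hf) (Rat.computable_den.comp hg))
    fun a => Nat.mul_ne_zero (f a).den_nz (g a).den_nz).of_eq fun a => ?_
  push_cast
  rw [← div_mul_div_comm, Rat.natAbs_num_div_den (hf0 a), Rat.natAbs_num_div_den (hg0 a)]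

theorem Computable.rat_decide_le {f g : α → ℚ} (hf : Computable f) (hg : Computable g)
    (hf0 : ∀ a, 0 ≤ f a) (hg0 : ∀ a, 0 ≤ g a) : Computable fun a => decide (f a ≤ g a) := by
  refine (Primrec.nat_le.decide.to_comp.comp
      (Primrec.nat_mul.to_comp.comp (Rat.computable_natAbs_num.comp hf)
        (Rat.computable_den.comp hg))
      (Primrec.nat_mul.to_comp.comp (Rat.computable_natAbs_num.comp hg)
        (Rat.computable_den.comp hf))).of_eq fun a => ?_
  rw [decide_eq_decide]
  conv_rhs => rw [← Rat.natAbs_num_div_den (hf0 a), ← Rat.natAbs_num_div_den (hg0 a)]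
  rw [div_le_div_iff₀ (Nat.cast_pos.2 (f a).den_pos) (Nat.cast_pos.2 (g a).den_pos)]
  norm_cast

theorem Computable.rat_sum_range {f : α → ℕ → ℚ} {N : α → ℕ} (hf : Computable₂ f)
    (hN : Computable N) (hf0 : ∀ a n, 0 ≤ f a n) :
    Computable fun a => ∑ n ∈ Finset.range (N a), f a n := by
  have hstep : Computable₂ fun (a : α) (p : ℕ × ℚ) => |p.2| + f a p.1 := by
    have habs : Computable fun q : ℚ => |q| :=
      (Computable.rat_natCast_div Rat.computable_natAbs_num Rat.computable_den
        fun r => r.den_nz).of_eq fun q => by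
          rw [← Rat.natAbs_num_div_den (abs_nonneg q)]; simp
    refine Computable.rat_add (habs.comp (Computable.snd.comp Computable.snd))
      (hf.comp Computable.fst (Computable.fst.comp Computable.snd))
      (fun _ => abs_nonneg _) fun _ => hf0 _ _
  refine (Computable.nat_rec hN (Computable.const (0 : ℚ)) hstep).of_eq fun a => ?_
  induction N a with
  | zero => rfl
  | succ n ih =>
    rw [Finset.sum_range_succ, ← ih]
    simp only
    rw [abs_of_nonneg]
    rw [ih]
    exact Finset.sum_nonneg fun n _ => hf0 a n

theorem Computable.decide_forall_lt {p : α → ℕ → Bool} {N : α → ℕ} (hp : Computable₂ p)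
    (hN : Computable N) : Computable fun a => decide (∀ n < N a, p a n = true) := by
  have hstep : Computable₂ fun (a : α) (q : ℕ × Bool) => q.2 && p a q.1 :=
    Primrec.and.to_comp.comp (Computable.snd.comp Computable.snd)
      (hp.comp Computable.fst (Computable.fst.comp Computable.snd))
  refine (Computable.nat_rec hN (Computable.const true) hstep).of_eq fun a => ?_
  induction N a with
  | zero => simp
  | succ n ih =>
    simp only
    rw [ih, Bool.eq_iff_iff]
    simp only [Bool.and_eq_true, decide_eq_true_eq, Nat.lt_succ_iff_lt_or_eq, or_imp, forall_and,
      forall_eq]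

end RationalFunctions

/-- The weight `1 / (2 ^ L * (L * (L + 1)))` with `L = ⌊log₂ i⌋`, comparable to
`1 / (i (log i)²)`. -/
def logWeight (i : ℕ) : ℚ :=
  (1 : ℕ) / (2 ^ Nat.log 2 i * (Nat.log 2 i * (Nat.log 2 i + 1)) : ℕ)

theorem logWeight_nonneg (i : ℕ) : 0 ≤ logWeight i := by
  unfold logWeight; positivity

theorem sum_logWeight (j : ℕ) :
    ∑ n ∈ Finset.range j, logWeight (n + 2) =
      1 - 1 / Nat.log 2 (j + 2) + ((j + 2 : ℕ) - 2 ^ Nat.log 2 (j + 2)) *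
        logWeight (j + 2) := by
  induction j with
  | zero =>
    have h : Nat.log 2 2 = 1 := by decide
    simp [h]
  | succ j ih =>
    rw [Finset.sum_range_succ, ih]
    set L := Nat.log 2 (j + 2) with hL
    have hL1 : 1 ≤ L := Nat.log_pos (by norm_num) (by omega)
    have hlo : 2 ^ L ≤ j + 2 := Nat.pow_log_le_self 2 (by omega)
    have hhi : j + 2 < 2 ^ (L + 1) := Nat.lt_pow_succ_log_self (by norm_num) _
    have hLq : (L : ℚ) ≠ 0 := by positivity
    rcases Nat.lt_or_ge (j + 3) (2 ^ (L + 1)) with h | h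
    · have h' : Nat.log 2 (j + 1 + 2) = L := Nat.log_eq_of_pow_le_of_lt_pow (by omega) (by omega)
      simp only [logWeight, h', ← hL]
      push_cast
      ring
    · have h' : Nat.log 2 (j + 1 + 2) = L + 1 :=
        Nat.log_eq_of_pow_le_of_lt_pow (by omega) (by rw [pow_succ]; omega)
      have hj : (j : ℚ) + 3 = 2 * 2 ^ L := by
        have : j + 3 = 2 ^ (L + 1) := by omega
        rw [pow_succ'] at this
        exact_mod_cast this
      have hj' : (j : ℚ) = 2 * 2 ^ L - 3 := by linarith
      simp only [logWeight, h', ← hL]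
      push_cast
      rw [hj', pow_succ]
      field_simp
      ring

theorem sum_logWeight_le_one (j : ℕ) : ∑ n ∈ Finset.range j, logWeight (n + 2) ≤ 1 := by
  rw [sum_logWeight]
  set L := Nat.log 2 (j + 2) with hL
  have hL1 : 1 ≤ L := Nat.log_pos (by norm_num) (by omega)
  have hhi : j + 2 < 2 ^ (L + 1) := Nat.lt_pow_succ_log_self (by norm_num) _
  have hhi' : ((j + 2 : ℕ) : ℚ) ≤ 2 * 2 ^ L := by
    rw [pow_succ'] at hhi
    exact_mod_cast hhi.le
  have hb : (((j + 2 : ℕ) : ℚ) - 2 ^ L) * logWeight (j + 2) ≤ 2 ^ L * logWeight (j + 2) :=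
    mul_le_mul_of_nonneg_right (by linarith) (logWeight_nonneg _)
  have hLq : (0 : ℚ) < L := by positivity
  have he : 2 ^ L * logWeight (j + 2) = 1 / (L * (L + 1) : ℚ) := by
    simp only [logWeight, ← hL]
    push_cast
    field_simp
  have hc : 1 / (L * (L + 1) : ℚ) ≤ 1 / L := by
    apply one_div_le_one_div_of_le hLq
    nlinarith
  linarith

theorem half_le_logWeight_mul {i : ℕ} (hi : 2 ≤ i) :
    1 / 2 ≤ (logWeight i : ℝ) * i * Real.logb 2 i ^ 2 := by
  have hL1 : 1 ≤ Nat.log 2 i := Nat.log_pos (by norm_num) hi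
  have hlo : 2 ^ Nat.log 2 i ≤ i := Nat.pow_log_le_self 2 (by omega)
  have hlog : (Nat.log 2 i : ℝ) ≤ Real.logb 2 i := by exact_mod_cast Real.natLog_le_logb i 2
  unfold logWeight
  generalize Nat.log 2 i = L at *
  have hlo' : (2 : ℝ) ^ L ≤ i := by exact_mod_cast hlo
  have hL : (1 : ℝ) ≤ L := by exact_mod_cast hL1
  push_cast
  rw [one_div_mul_eq_div, div_mul_eq_mul_div, div_le_div_iff₀ (by norm_num) (by positivity)]
  have h1 : (L : ℝ) * (L + 1) ≤ 2 * Real.logb 2 i ^ 2 := by nlinarith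
  calc 1 * ((2 : ℝ) ^ L * (L * (L + 1))) ≤ i * (2 * Real.logb 2 i ^ 2) := by
        rw [one_mul]; gcongr
    _ = _ := by ring

theorem Primrec.two_pow : Primrec fun n : ℕ => 2 ^ n := by
  have h : Primrec₂ fun (_ : ℕ) (p : ℕ × ℕ) => 2 * p.2 :=
    Primrec.nat_double.comp (Primrec.snd.comp Primrec.snd)
  refine (Primrec.nat_rec' Primrec.id (Primrec.const 1) h).of_eq fun n => ?_
  induction n with
  | zero => rfl
  | succ n ih => rw [pow_succ', ← ih]; rfl

theorem Primrec.nat_log_two : Primrec (Nat.log 2) := by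
  have h : PrimrecRel fun (n L : ℕ) => 2 ^ L ≤ n ∧ n ≠ 0 :=
    (Primrec.nat_le.comp (Primrec.two_pow.comp Primrec.snd) Primrec.fst).and
      (Primrec.eq.comp Primrec.fst (Primrec.const 0)).not
  refine (Primrec.nat_findGreatest Primrec.id h).of_eq fun n => ?_
  rcases eq_or_ne n 0 with rfl | hn
  · simp
  refine le_antisymm ?_ ?_
  · refine Nat.le_log_of_pow_le (by norm_num) ?_
    exact (Nat.findGreatest_spec (P := fun L => 2 ^ L ≤ n ∧ n ≠ 0) (Nat.zero_le _)
      ⟨by simp; omega, hn⟩).1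
  · exact Nat.le_findGreatest (Nat.log_le_self 2 n) ⟨Nat.pow_log_le_self 2 hn, hn⟩

theorem computable_logWeight : Computable fun j => logWeight (j + 2) := by
  have hlog : Primrec fun j : ℕ => Nat.log 2 (j + 2) :=
    Primrec.nat_log_two.comp (Primrec.succ.comp Primrec.succ)
  refine Computable.rat_natCast_div (Computable.const 1) (Primrec.nat_mul.comp
    (Primrec.two_pow.comp hlog) (Primrec.nat_mul.comp hlog (Primrec.succ.comp hlog))).to_comp ?_
  intro j
  have hL1 : 0 < Nat.log 2 (j + 2) := Nat.log_pos (by norm_num) (by omega)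
  positivity

/-- A bound for the codes of bitstrings of length at most `n`. -/
def stringCodeBound (n : ℕ) : ℕ := Nat.rec 0 (fun _ b => Nat.succ (Nat.pair 1 b)) n

theorem encode_le_stringCodeBound {x : List Bool} {n : ℕ} (hx : x.length ≤ n) :
    Encodable.encode x ≤ stringCodeBound n := by
  induction n generalizing x with
  | zero =>
    rw [List.length_eq_zero_iff.1 (Nat.le_zero.1 hx)]
    simp [stringCodeBound]
  | succ n ih =>
    cases x with
    | nil => simp
    | cons b l =>
      have hl := ih (x := l) (by simpa using hx)
      have hb : Encodable.encode b ≤ 1 := by cases b <;> simp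
      rw [Encodable.encode_list_cons]
      have h1 : StrictMono fun a => Nat.pair a (Encodable.encode l) :=
        fun _ _ h => Nat.pair_lt_pair_left _ h
      have h2 : StrictMono (Nat.pair 1) := fun _ _ h => Nat.pair_lt_pair_right _ h
      exact Nat.succ_le_succ ((h1.monotone hb).trans (h2.monotone hl))

theorem primrec_stringCodeBound : Primrec stringCodeBound :=
  Primrec.nat_rec₁ 0 ((Primrec.succ.comp (Primrec₂.natPair.comp (Primrec.const 1) Primrec.snd)).to₂)

/-- The bitstring with code `n`. -/
def stringOfCode (n : ℕ) : List Bool := (Encodable.decode n).getD []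

theorem stringOfCode_encode (x : List Bool) : stringOfCode (Encodable.encode x) = x := by
  simp [stringOfCode]

theorem primrec_stringOfCode : Primrec stringOfCode :=
  Primrec.option_getD.comp Primrec.decode (Primrec.const [])

/-- Whether at stage `S` the values `M x S` exceed `4⁻ᵏ` times the weighted values `f x t`, for all
strings `x` whose code is within the bound for length `j + 2`; here `p = (j, t)`. -/
def caughtUp (M f : List Bool → ℕ → ℚ) (k S : ℕ) (p : ℕ × ℕ) : Bool :=
  decide (∀ n < stringCodeBound (p.1 + 2) + 1,
    decide ((1 / 2) ^ (2 * k) * logWeight (p.1 + 2) * f (stringOfCode n) p.2 ≤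
      M (stringOfCode n) S) = true)

/-- The pair `(j, t)` reached at stage `S`: the index `j` of the current target together with the
stage `t ≤ S` at which this target was set. It is replaced by `(j + 1, S + 1)` once `M` has caught
up with the target. -/
def targetState (M f : List Bool → ℕ → ℚ) (k S : ℕ) : ℕ × ℕ :=
  Nat.rec (0, 0) (fun S p => bif caughtUp M f k S p then (p.1 + 1, S + 1) else p) S

/-- The mass given to `x` if a new target is set at stage `S`. -/
def targetMass (M f : List Bool → ℕ → ℚ) (x : List Bool) (k S : ℕ) : ℚ :=
  bif decide ((targetState M f k S).2 = S) then
    (1 / 2) ^ (k + 1) * logWeight ((targetState M f k S).1 + 2) * f x S else 0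

/-- The total mass given to `x` by the first `T` constructions during the first `T` stages. -/
def targetSum (M f : List Bool → ℕ → ℚ) (x : List Bool) (T : ℕ) : ℚ :=
  ∑ k ∈ Finset.range T, ∑ S ∈ Finset.range T, targetMass M f x k S

theorem computable_half_pow : Computable fun n : ℕ => (1 / 2 : ℚ) ^ n :=
  (Computable.rat_natCast_div (Computable.const 1) Primrec.two_pow.to_comp
    fun n => by positivity).of_eq fun n => by simp

section Target

variable {M f : List Bool → ℕ → ℚ}

theorem targetState_succ (k S : ℕ) : targetState M f k (S + 1) =
    bif caughtUp M f k S (targetState M f k S) then ((targetState M f k S).1 + 1, S + 1)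
    else targetState M f k S := rfl

theorem targetMass_nonneg (hf : ∀ x s, 0 ≤ f x s) (x : List Bool) (k S : ℕ) :
    0 ≤ targetMass M f x k S := by
  unfold targetMass
  cases decide ((targetState M f k S).2 = S)
  · exact le_rfl
  · exact mul_nonneg (mul_nonneg (by positivity) (logWeight_nonneg _)) (hf _ _)

theorem computable_caughtUp {α : Type*} [Primcodable α] (hM : Computable₂ M)
    (hM0 : ∀ x s, 0 ≤ M x s) (hf : Computable₂ f) (hf0 : ∀ x s, 0 ≤ f x s)
    {k S : α → ℕ} {p : α → ℕ × ℕ} (hk : Computable k) (hS : Computable S) (hp : Computable p) :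
    Computable fun a => caughtUp M f (k a) (S a) (p a) := by
  have hx : Computable fun b : α × ℕ => stringOfCode b.2 :=
    primrec_stringOfCode.to_comp.comp Computable.snd
  have hp' : Computable fun b : α × ℕ => p b.1 := hp.comp Computable.fst
  have hkq : Computable fun b : α × ℕ => (1 / 2 : ℚ) ^ (2 * k b.1) :=
    computable_half_pow.comp (Primrec.nat_double.to_comp.comp (hk.comp Computable.fst))
  have hjw : Computable fun b : α × ℕ => logWeight ((p b.1).1 + 2) :=
    computable_logWeight.comp (Computable.fst.comp hp')
  have hfx : Computable fun b : α × ℕ => f (stringOfCode b.2) (p b.1).2 :=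
    hf.comp hx (Computable.snd.comp hp')
  have hMx : Computable fun b : α × ℕ => M (stringOfCode b.2) (S b.1) :=
    hM.comp hx (hS.comp Computable.fst)
  have hw0 : ∀ b : α × ℕ, 0 ≤ (1 / 2 : ℚ) ^ (2 * k b.1) * logWeight ((p b.1).1 + 2) :=
    fun b => mul_nonneg (by positivity) (logWeight_nonneg _)
  have hle := Computable.rat_decide_le (Computable.rat_mul (Computable.rat_mul hkq hjw
    (fun b => by positivity) fun b => logWeight_nonneg _) hfx hw0 fun b => hf0 _ _) hMx
    (fun b => mul_nonneg (hw0 b) (hf0 _ _)) fun b => hM0 _ _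
  have hN : Computable fun a => stringCodeBound ((p a).1 + 2) + 1 :=
    (Primrec.succ.comp (primrec_stringCodeBound.comp
      (Primrec.succ.comp Primrec.succ))).to_comp.comp (Computable.fst.comp hp)
  exact Computable.decide_forall_lt (p := fun a n =>
    decide ((1 / 2) ^ (2 * k a) * logWeight ((p a).1 + 2) * f (stringOfCode n) (p a).2 ≤
      M (stringOfCode n) (S a))) hle hN

theorem computable_targetState {α : Type*} [Primcodable α] (hM : Computable₂ M)
    (hM0 : ∀ x s, 0 ≤ M x s) (hf : Computable₂ f) (hf0 : ∀ x s, 0 ≤ f x s)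
    {k S : α → ℕ} (hk : Computable k) (hS : Computable S) :
    Computable fun a => targetState M f (k a) (S a) := by
  have hn : Computable fun b : α × ℕ × (ℕ × ℕ) => b.2.1 := Computable.fst.comp Computable.snd
  have hp : Computable fun b : α × ℕ × (ℕ × ℕ) => b.2.2 := Computable.snd.comp Computable.snd
  have hc : Computable fun b : α × ℕ × (ℕ × ℕ) => caughtUp M f (k b.1) b.2.1 b.2.2 :=
    computable_caughtUp hM hM0 hf hf0 (hk.comp Computable.fst) hn hp
  have hnext : Computable fun b : α × ℕ × (ℕ × ℕ) => (b.2.2.1 + 1, b.2.1 + 1) :=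
    (Computable.succ.comp (Computable.fst.comp hp)).pair (Computable.succ.comp hn)
  have hstep : Computable₂ fun (a : α) (q : ℕ × (ℕ × ℕ)) =>
      bif caughtUp M f (k a) q.1 q.2 then (q.2.1 + 1, q.1 + 1) else q.2 :=
    Computable.cond hc hnext hp
  have h := Computable.nat_rec hS (Computable.const ((0, 0) : ℕ × ℕ)) hstep
  exact h

theorem computable_targetMass {α : Type*} [Primcodable α] (hM : Computable₂ M)
    (hM0 : ∀ x s, 0 ≤ M x s) (hf : Computable₂ f) (hf0 : ∀ x s, 0 ≤ f x s)
    {x : α → List Bool} {k S : α → ℕ} (hx : Computable x) (hk : Computable k)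
    (hS : Computable S) : Computable fun a => targetMass M f (x a) (k a) (S a) := by
  have hst := computable_targetState hM hM0 hf hf0 hk hS
  have hfresh : Computable fun a => decide ((targetState M f (k a) (S a)).2 = S a) :=
    Primrec.eq.decide.to_comp.comp (Computable.snd.comp hst) hS
  have hkq : Computable fun a => (1 / 2 : ℚ) ^ (k a + 1) :=
    computable_half_pow.comp (Computable.succ.comp hk)
  have hjw : Computable fun a => logWeight ((targetState M f (k a) (S a)).1 + 2) :=
    computable_logWeight.comp (Computable.fst.comp hst)
  exact Computable.cond hfresh (Computable.rat_mul (Computable.rat_mul hkq hjw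
    (fun a => by positivity) fun a => logWeight_nonneg _) (hf.comp hx hS)
    (fun a => mul_nonneg (by positivity) (logWeight_nonneg _)) fun a => hf0 _ _)
    (Computable.const 0)

theorem computable_targetSum (hM : Computable₂ M) (hM0 : ∀ x s, 0 ≤ M x s)
    (hf : Computable₂ f) (hf0 : ∀ x s, 0 ≤ f x s) : Computable₂ (targetSum M f) := by
  have hmass : Computable₂ fun (b : (List Bool × ℕ) × ℕ) (S : ℕ) =>
      targetMass M f b.1.1 b.2 S :=
    computable_targetMass hM hM0 hf hf0
      (Computable.fst.comp (Computable.fst.comp Computable.fst))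
      (Computable.snd.comp Computable.fst) Computable.snd
  have hinner : Computable₂ fun (b : List Bool × ℕ) (k : ℕ) =>
      ∑ S ∈ Finset.range b.2, targetMass M f b.1 k S :=
    Computable.rat_sum_range hmass (Computable.snd.comp Computable.fst)
      fun b S => targetMass_nonneg hf0 _ _ _
  exact Computable.rat_sum_range hinner Computable.snd
    fun b k => Finset.sum_nonneg fun S _ => targetMass_nonneg hf0 _ _ _

theorem targetState_snd_le (k S : ℕ) : (targetState M f k S).2 ≤ S := by
  induction S with
  | zero => exact le_rfl
  | succ S ih =>
    rw [targetState_succ]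
    cases caughtUp M f k S (targetState M f k S)
    · exact ih.trans (Nat.le_succ S)
    · exact le_rfl

theorem sum_logWeight_targetState (k T : ℕ) :
    ∑ S ∈ Finset.range (T + 1), (if (targetState M f k S).2 = S then
        logWeight ((targetState M f k S).1 + 2) else 0) =
      ∑ j ∈ Finset.range ((targetState M f k T).1 + 1), logWeight (j + 2) := by
  induction T with
  | zero => simp [targetState]
  | succ T ih =>
    rw [Finset.sum_range_succ, ih, targetState_succ]
    cases caughtUp M f k T (targetState M f k T)
    · have h : (targetState M f k T).2 ≠ T + 1 :=
        ((targetState_snd_le k T).trans_lt (Nat.lt_succ_self T)).ne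
      simp [h]
    · simp [Finset.sum_range_succ _ ((targetState M f k T).1 + 1)]

theorem sum_logWeight_targetState_le_one (k T : ℕ) :
    ∑ S ∈ Finset.range T, (if (targetState M f k S).2 = S then
        logWeight ((targetState M f k S).1 + 2) else 0) ≤ 1 := by
  cases T with
  | zero => simp
  | succ T => exact (sum_logWeight_targetState k T).trans_le (sum_logWeight_le_one _)

theorem sum_half_pow_succ_le_one (T : ℕ) : ∑ k ∈ Finset.range T, (1 / 2 : ℚ) ^ (k + 1) ≤ 1 := by
  have h : ∑ k ∈ Finset.range T, (1 / 2 : ℚ) ^ (k + 1) = 1 - (1 / 2) ^ T := by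
    induction T with
    | zero => simp
    | succ T ih => rw [Finset.sum_range_succ, ih]; ring
  rw [h]
  linarith [show (0 : ℚ) ≤ (1 / 2) ^ T by positivity]

theorem sum_targetSum_le_one (hfs : ∀ s (F : Finset (List Bool)), ∑ x ∈ F, f x s ≤ 1)
    (F : Finset (List Bool)) (T : ℕ) : ∑ x ∈ F, targetSum M f x T ≤ 1 := by
  have hmass : ∀ k S, ∑ x ∈ F, targetMass M f x k S ≤
      (1 / 2) ^ (k + 1) * (if (targetState M f k S).2 = S then
        logWeight ((targetState M f k S).1 + 2) else 0) := by
    intro k S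
    unfold targetMass
    by_cases h : (targetState M f k S).2 = S
    · simp only [h, decide_true, cond_true, if_true]
      rw [← Finset.mul_sum]
      exact mul_le_of_le_one_right (mul_nonneg (by positivity) (logWeight_nonneg _)) (hfs S F)
    · simp [h]
  unfold targetSum
  rw [Finset.sum_comm]
  calc ∑ k ∈ Finset.range T, ∑ x ∈ F, ∑ S ∈ Finset.range T, targetMass M f x k S
      ≤ ∑ k ∈ Finset.range T, (1 / 2 : ℚ) ^ (k + 1) := by
        refine Finset.sum_le_sum fun k _ => ?_
        rw [Finset.sum_comm]
        refine (Finset.sum_le_sum fun S _ => hmass k S).trans ?_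
        rw [← Finset.mul_sum]
        exact mul_le_of_le_one_right (by positivity) (sum_logWeight_targetState_le_one k T)
    _ ≤ 1 := sum_half_pow_succ_le_one T

theorem targetSum_mono (hf : ∀ x s, 0 ≤ f x s) (x : List Bool) : Monotone (targetSum M f x) := by
  intro T T' h
  have hsub := Finset.range_mono h
  calc targetSum M f x T ≤ ∑ k ∈ Finset.range T, ∑ S ∈ Finset.range T', targetMass M f x k S :=
        Finset.sum_le_sum fun k _ =>
          Finset.sum_le_sum_of_subset_of_nonneg hsub fun S _ _ => targetMass_nonneg hf _ _ _
    _ ≤ targetSum M f x T' := Finset.sum_le_sum_of_subset_of_nonneg hsub fun k _ _ =>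
        Finset.sum_nonneg fun S _ => targetMass_nonneg hf _ _ _

theorem le_targetSum (hf : ∀ x s, 0 ≤ f x s) (x : List Bool) {k j S : ℕ}
    (hS : targetState M f k S = (j, S)) :
    (1 / 2) ^ (k + 1) * logWeight (j + 2) * f x S ≤ targetSum M f x (max k S + 1) := by
  have h1 : (1 / 2) ^ (k + 1) * logWeight (j + 2) * f x S = targetMass M f x k S := by
    simp [targetMass, hS]
  rw [h1]
  unfold targetSum
  generalize hN : max k S + 1 = N
  have hk : k ∈ Finset.range N := by simp [← hN]
  have hSN : S ∈ Finset.range N := by simp [← hN]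
  refine (Finset.single_le_sum (f := fun S => targetMass M f x k S)
    (fun S _ => targetMass_nonneg hf x k S) hSN).trans ?_
  exact Finset.single_le_sum (f := fun k => ∑ S ∈ Finset.range N, targetMass M f x k S)
    (fun k _ => Finset.sum_nonneg fun S _ => targetMass_nonneg hf x k S) hk

theorem exists_next_target {k j S T : ℕ} (hS : targetState M f k S = (j, S)) (hST : S ≤ T)
    (hM : ∀ x, Monotone (M x)) (hT : caughtUp M f k T (j, S) = true) :
    ∃ S', targetState M f k S' = (j + 1, S') ∧ ∀ x : List Bool, x.length ≤ j + 2 →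
      (1 / 2) ^ (2 * k) * logWeight (j + 2) * f x S ≤ M x S' := by
  have hnext : ∀ U, targetState M f k U = (j, S) → caughtUp M f k U (j, S) = true →
      ∃ S', targetState M f k S' = (j + 1, S') ∧ ∀ x : List Bool, x.length ≤ j + 2 →
        (1 / 2) ^ (2 * k) * logWeight (j + 2) * f x S ≤ M x S' := by
    intro U hU hc
    refine ⟨U + 1, by simp [targetState_succ, hU, hc], fun x hx => ?_⟩
    have := of_decide_eq_true ((of_decide_eq_true hc) (Encodable.encode x)
      (Nat.lt_succ_of_le (encode_le_stringCodeBound hx)))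
    rw [stringOfCode_encode] at this
    exact this.trans (hM x (Nat.le_succ U))
  by_contra hno
  have hstay : ∀ n, targetState M f k (S + n) = (j, S) := by
    intro n
    induction n with
    | zero => exact hS
    | succ n ih =>
      rw [← add_assoc, targetState_succ, ih]
      cases hc : caughtUp M f k (S + n) (j, S)
      · rfl
      · exact absurd (hnext _ ih hc) hno
  refine hno (hnext T ?_ hT)
  rw [← Nat.add_sub_cancel' hST]
  exact hstay _

end Target

theorem qval_mono : Monotone qval := fun _ _ h => ENNReal.ofReal_le_ofReal (Rat.cast_le.2 h)

theorem sum_qval_le_one {F : Finset (List Bool)} {g : List Bool → ℚ} (hg : ∀ x, 0 ≤ g x)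
    (h : ∑ x ∈ F, g x ≤ 1) : ∑ x ∈ F, qval (g x) ≤ 1 := by
  unfold qval
  rw [← ENNReal.ofReal_sum_of_nonneg fun x _ => Rat.cast_nonneg.2 (hg x), ← Rat.cast_sum,
    ← ENNReal.ofReal_one]
  exact ENNReal.ofReal_le_ofReal (by exact_mod_cast h)

theorem sum_le_one_of_tsum_qval_le_one {F : Finset (List Bool)} {g : List Bool → ℚ}
    (hg : ∀ x, 0 ≤ g x) (h : ∑' x, qval (g x) ≤ 1) : ∑ x ∈ F, g x ≤ 1 := by
  have h1 := (ENNReal.sum_le_tsum F).trans h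
  unfold qval at h1
  rw [← ENNReal.ofReal_sum_of_nonneg fun x _ => Rat.cast_nonneg.2 (hg x), ← Rat.cast_sum,
    ENNReal.ofReal_le_one] at h1
  exact_mod_cast h1

theorem isSemimeasure_iSup_qval {g : List Bool → ℕ → ℚ} (hg : ∀ x T, 0 ≤ g x T)
    (hmono : ∀ x, Monotone (g x)) (hsum : ∀ (F : Finset (List Bool)) T, ∑ x ∈ F, g x T ≤ 1) :
    IsSemimeasure fun x => ⨆ T, qval (g x T) := by
  unfold IsSemimeasure
  rw [ENNReal.tsum_eq_iSup_sum]
  refine iSup_le fun F => ?_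
  rw [ENNReal.finsetSum_iSup_of_monotone (f := fun x T => qval (g x T))
    fun x => qval_mono.comp (hmono x)]
  exact iSup_le fun T => sum_qval_le_one (fun x => hg x T) (hsum F T)

theorem exists_caughtUp {m : List Bool → ℝ≥0∞} {M f : List Bool → ℕ → ℚ}
    (hM : IsApproxFromBelow m M) (hf : ∀ x s, 0 ≤ f x s) {k j S : ℕ} (hS : targetState M f k S = (j, S)) {c : ℝ≥0}
    (hc : 2 * c < 2 ^ k) (hdom : ∀ x, ⨆ T, qval (targetSum M f x T) ≤ c * m x) :
    ∃ T, S ≤ T ∧ caughtUp M f k T (j, S) = true := by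
  obtain ⟨-, hM0, hMmono, hMsup⟩ := hM
  have hx : ∀ x, ∃ T, (1 / 2) ^ (2 * k) * logWeight (j + 2) * f x S ≤ M x T := by
    intro x
    set q := logWeight (j + 2) * f x S with hq
    have hq0 : 0 ≤ q := mul_nonneg (logWeight_nonneg _) (hf _ _)
    rw [mul_assoc, ← hq]
    rcases hq0.eq_or_lt with h0 | hpos
    · exact ⟨0, by rw [← h0, mul_zero]; exact hM0 x 0⟩
    have h1 : qval ((1 / 2) ^ (k + 1) * q) ≤ c * m x := by
      refine le_trans ?_ (hdom x)
      refine le_trans (qval_mono ?_) (le_iSup (fun T => qval (targetSum M f x T)) (max k S + 1))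
      rw [hq, ← mul_assoc]
      exact le_targetSum hf x hS
    by_contra! hno
    have h2 : m x ≤ qval ((1 / 2) ^ (2 * k) * q) := by
      rw [hMsup]
      exact iSup_le fun T => qval_mono (hno T).le
    have h3 := h1.trans (mul_le_mul_right h2 _)
    unfold qval at h3
    rw [← ENNReal.ofReal_coe_nnreal, ← ENNReal.ofReal_mul c.coe_nonneg,
      ENNReal.ofReal_le_ofReal_iff (by positivity)] at h3
    push_cast at h3
    have hqr : (0 : ℝ) < q := Rat.cast_pos.2 hpos
    have hc' : (2 * c : ℝ) < 2 ^ k := by exact_mod_cast hc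
    rw [← mul_assoc] at h3
    have h4 := le_of_mul_le_mul_right h3 hqr
    have hpow : (1 / 2 : ℝ) ^ k * 2 ^ k = 1 := by rw [← mul_pow]; norm_num
    have hpk : (0 : ℝ) < (1 / 2) ^ k := by positivity
    rw [pow_succ, two_mul, pow_add] at h4
    have h5 : 2 * c * (1 / 2 : ℝ) ^ k < 1 := by nlinarith
    nlinarith
  choose T hT using hx
  let B := (Finset.range (stringCodeBound (j + 2) + 1)).sup fun n => T (stringOfCode n)
  refine ⟨max S B, le_max_left _ _, decide_eq_true fun n hn => decide_eq_true ?_⟩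
  refine (hT (stringOfCode n)).trans (hMmono _ (le_trans ?_ (le_max_right _ _)))
  exact Finset.le_sup (f := fun n => T (stringOfCode n)) (Finset.mem_range.2 hn)

/-- If `M x t'` exceeds `4⁻ᵏ` times the weighted value `f x t`, then `M x` has doubled or the ratio
of `f x t` to `M x t` is small. -/
theorem doubling_or_div_lt {a a' b : ℚ} {k i : ℕ} (ha : 0 ≤ a) (hb : 0 ≤ b) (hi : 2 ≤ i)
    (h : (1 / 2) ^ (2 * k) * logWeight i * b ≤ a') :
    2 * qval a ≤ qval a' ∨
      qval b / qval a < ENNReal.ofReal (2 * (2 * 2 ^ (2 * k)) * i * Real.logb 2 i ^ 2) := by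
  rw [or_iff_not_imp_right, not_lt]
  intro hle
  rcases ha.eq_or_lt with rfl | hapos
  · simp [qval]
  have har : (0 : ℝ) < a := Rat.cast_pos.2 hapos
  have hbr : (0 : ℝ) ≤ b := Rat.cast_nonneg.2 hb
  have hqa : qval a ≠ 0 := (ENNReal.ofReal_pos.2 har).ne'
  rw [ENNReal.le_div_iff_mul_le (Or.inl hqa) (Or.inl ENNReal.ofReal_ne_top)] at hle
  unfold qval at hle ⊢
  rw [← ENNReal.ofReal_mul (by positivity), ENNReal.ofReal_le_ofReal_iff hbr] at hle
  have h2 : (2 : ℝ≥0∞) = ENNReal.ofReal 2 := by simp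
  rw [h2, ← ENNReal.ofReal_mul (by norm_num)]
  refine ENNReal.ofReal_le_ofReal ?_
  have hr : (1 / 2 : ℝ) ^ (2 * k) * logWeight i * b ≤ a' := by
    have h' := Rat.cast_le (K := ℝ).2 h
    push_cast at h'
    exact h'
  refine le_trans ?_ hr
  have hw := half_le_logWeight_mul hi
  have hw0 : (0 : ℝ) ≤ logWeight i := Rat.cast_nonneg.2 (logWeight_nonneg i)
  have hpow : (1 / 2 : ℝ) ^ (2 * k) * 2 ^ (2 * k) = 1 := by rw [← mul_pow]; norm_num
  calc 2 * (a : ℝ) ≤ 4 * ((logWeight i : ℝ) * i * Real.logb 2 i ^ 2) * a := by nlinarith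
    _ = (1 / 2 : ℝ) ^ (2 * k) * 2 ^ (2 * k) *
        (4 * ((logWeight i : ℝ) * i * Real.logb 2 i ^ 2) * a) := by rw [hpow, one_mul]
    _ = (1 / 2 : ℝ) ^ (2 * k) * logWeight i *
        (2 * (2 * 2 ^ (2 * k)) * i * Real.logb 2 i ^ 2 * a) := by ring
    _ ≤ _ := by gcongr

theorem exists_target_sequence {m : List Bool → ℝ≥0∞} {M f : List Bool → ℕ → ℚ}
    (hm : IsUniversalSemimeasure m) (hM : IsApproxFromBelow m M) (hf : Computable₂ f)
    (hf0 : ∀ x s, 0 ≤ f x s) (hfs : ∀ s (F : Finset (List Bool)), ∑ x ∈ F, f x s ≤ 1) :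
    ∃ (k : ℕ) (t : ℕ → ℕ), ∀ (j : ℕ) (x : List Bool), x.length ≤ j + 2 →
      (1 / 2) ^ (2 * k) * logWeight (j + 2) * f x (t j) ≤ M x (t (j + 1)) := by
  have hg0 : ∀ x T, 0 ≤ targetSum M f x T := fun x T =>
    Finset.sum_nonneg fun k _ => Finset.sum_nonneg fun S _ => targetMass_nonneg hf0 _ _ _
  obtain ⟨c, -, hdom⟩ := hm.2.2 (fun x => ⨆ T, qval (targetSum M f x T))
    (isSemimeasure_iSup_qval hg0 (targetSum_mono hf0) (sum_targetSum_le_one hfs))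
    ⟨targetSum M f, computable_targetSum hM.1 hM.2.1 hf hf0, hg0, targetSum_mono hf0, fun _ => rfl⟩
  obtain ⟨k, hk⟩ := pow_unbounded_of_one_lt (2 * c) (one_lt_two : (1 : ℝ≥0) < 2)
  have hnext : ∀ j S, ∃ S', targetState M f k S = (j, S) → targetState M f k S' = (j + 1, S') ∧
      ∀ x : List Bool, x.length ≤ j + 2 →
        (1 / 2) ^ (2 * k) * logWeight (j + 2) * f x S ≤ M x S' := by
    intro j S
    by_cases hS : targetState M f k S = (j, S)
    · obtain ⟨T, hST, hT⟩ := exists_caughtUp hM hf0 hS hk hdom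
      obtain ⟨S', h⟩ := exists_next_target hS hST hM.2.2.1 hT
      exact ⟨S', fun _ => h⟩
    · exact ⟨0, fun h => absurd h hS⟩
  choose next hnext using hnext
  let t : ℕ → ℕ := fun j => Nat.rec 0 (fun j S => next j S) j
  have ht : ∀ j, targetState M f k (t j) = (j, t j) := by
    intro j
    induction j with
    | zero => rfl
    | succ j ih => exact (hnext j (t j) ih).1
  exact ⟨k, t, fun j => (hnext j (t j) (ht j)).2⟩

theorem Computable.comp_pair_self {α β σ : Type*} [Primcodable α] [Primcodable β] [Primcodable σ]
    {F : ℕ → α → β → σ} {h : α × β → ℕ}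
    (hF : Computable fun p : ℕ × α × β => F p.1 p.2.1 p.2.2) (hh : Computable h) :
    Computable₂ fun a b => F (h (a, b)) a b :=
  hF.comp (hh.pair Computable.id)

/-- The claim inside the proof of Theorem 2: for every computable `h` there are a sequence
`t_1, t_2, …` and a constant `c > 0` such that for all `x` and `i ≥ max(|x|, 2)`, either
`m_{t_{i+1}}(x) ≥ 2 m_{t_i}(x)` or `u_h(x) < 2 c i (log i)²`. -/
theorem claim_doubling_or_small_test
    (m : List Bool → ℝ≥0∞) (ms : List Bool → ℕ → ℚ)
    (hm : IsUniversalSemimeasure m) (hms : IsApproxFromBelow m ms)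
    (c₀ : ℝ) (hc₀ : 0 < c₀)
    (hms1 : ∀ x : List Bool, ENNReal.ofReal (c₀ * 2 ^ (-2 * (x.length : ℝ))) ≤ qval (ms x 1))
    (mc : List Bool → ℕ → ℝ≥0∞) (mcs : ℕ → List Bool → ℕ → ℚ)
    (hmc : IsUniversalCondSemimeasure mc) (hmcs : IsCondApproxFromBelow mc mcs)
    (h : List Bool × ℕ → ℕ) (hh : Computable h) :
    ∃ (t : ℕ → ℕ) (c : ℝ), 0 < c ∧
      ∀ (x : List Bool) (i : ℕ), x.length ≤ i → 2 ≤ i →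
        2 * qval (ms x (t i)) ≤ qval (ms x (t (i + 1))) ∨
        (⨅ s : ℕ, qval (mcs (h (x, s)) x s) / qval (ms x s)) <
          ENNReal.ofReal (2 * c * i * (Real.logb 2 i) ^ 2) := by
  obtain ⟨hmcs, hmcs0, -, hmcsup⟩ := hmcs
  have hf : Computable₂ fun (x : List Bool) (s : ℕ) => mcs (h (x, s)) x s :=
    hmcs.comp_pair_self hh
  have hfs : ∀ s (F : Finset (List Bool)), ∑ x ∈ F, mcs (h (x, s)) x s ≤ 1 := by
    intro s F
    refine sum_le_one_of_tsum_qval_le_one (fun x => hmcs0 _ x s) ?_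
    refine (ENNReal.tsum_le_tsum fun x => ?_).trans (hmc.1 s)
    rw [hmcsup]
    exact le_iSup (fun t => qval (mcs t x s)) _
  obtain ⟨k, t, ht⟩ := exists_target_sequence hm hms hf (fun x s => hmcs0 _ x s) hfs
  refine ⟨fun i => t (i - 2), 2 * 2 ^ (2 * k), by positivity, fun x i hx hi => ?_⟩
  obtain ⟨j, rfl⟩ := Nat.exists_eq_add_of_le' hi
  exact (doubling_or_div_lt (hms.2.1 x (t j)) (hmcs0 _ x (t j)) hi (ht j x hx)).imp id
    (iInf_le _ (t j)).trans_lt
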